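/- arXiv:1404.0812 — 2 statements merged into one kernel-verified Lean document; each statement's English description precedes it below -/
import Mathlib

section
/- Let N ≥ 1 and let Φ be a real symmetric N×N matrix that is conditionally positive definite of order one, i.e., cᵀΦc > 0 for every nonzero vector c ∈ ℝᴺ with ∑_{i=1}^N c_i = 0. Then the bordered (N+1)×(N+1) matrix A = [[Φ, 𝟙], [𝟙ᵀ, 0]], obtained by appending a column of ones, a row of ones, and a zero in the bottom-right corner, is invertible. -/
open Matrix

/-- If `Φ` is a real symmetric `N × N` matrix that is conditionally positive definite of
order one (i.e. `cᵀ Φ c > 0` for every nonzero `c` with entries summing to zero), then the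
bordered `(N+1) × (N+1)` matrix `A = [[Φ, 𝟙], [𝟙ᵀ, 0]]` is invertible. -/
theorem bordered_cpd_matrix_invertible
    (N : ℕ) (hN : 1 ≤ N)
    (Φ : Matrix (Fin N) (Fin N) ℝ)
    (hsymm : Φ.IsSymm)
    (hcpd : ∀ c : Fin N → ℝ, c ≠ 0 → (∑ i, c i) = 0 → 0 < c ⬝ᵥ Φ.mulVec c) :
    IsUnit (Matrix.fromBlocks Φ
      (Matrix.of fun _ _ => (1 : ℝ))
      (Matrix.of fun _ _ => (1 : ℝ))
      (0 : Matrix Unit Unit ℝ)) := by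
  rw [← Matrix.mulVec_injective_iff_isUnit]
  refine (injective_iff_map_eq_zero (Matrix.mulVecLin _)).2 fun v hv => ?_
  obtain ⟨c, d, rfl⟩ : ∃ (c : Fin N → ℝ) (d : Unit → ℝ), v = Sum.elim c d :=
    ⟨v ∘ Sum.inl, v ∘ Sum.inr, (Sum.elim_comp_inl_inr v).symm⟩
  rw [Matrix.mulVecLin_apply, Matrix.fromBlocks_mulVec] at hv
  have hrow : ∀ i, (Φ *ᵥ c) i + d () = 0 := fun i => by
    simpa [Matrix.mulVec, dotProduct] using congrFun hv (Sum.inl i)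
  have hsum : ∑ i, c i = 0 := by
    simpa [Matrix.mulVec, dotProduct] using congrFun hv (Sum.inr ())
  have hc : c = 0 := by
    by_contra h
    refine (hcpd c h hsum).ne' ?_
    simp only [dotProduct, fun i => eq_neg_of_add_eq_zero_left (hrow i), ← Finset.sum_mul, hsum,
      zero_mul]
  have hd : d () = 0 := by simpa [hc] using hrow ⟨0, hN⟩
  ext (i | i)
  · simp [hc]
  · exact hd
end

section
/- Let α, β, γ, τ₁, τ₂ ∈ ℝ with γ = −α, α ≠ 0, and β ≠ −1. Then (u, v) = (0, 0) is the unique equilibrium point of the Turing reaction system, i.e., the unique solution (u, v) ∈ ℝ² of the pair of equations αu(1 − τ₁v²) + v(1 − τ₂u) = 0 and βv + ατ₁uv² + u(γ + τ₂v) = 0. -/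
/-- If `γ = -α`, `α ≠ 0`, and `β ≠ -1`, then `(u, v) = (0, 0)` is the unique equilibrium
of the Turing reaction system: the unique solution of
`αu(1 - τ₁v²) + v(1 - τ₂u) = 0` and `βv + ατ₁uv² + u(γ + τ₂v) = 0`. -/
theorem turing_unique_equilibrium
    (α β γ τ₁ τ₂ : ℝ) (hγ : γ = -α) (hα : α ≠ 0) (hβ : β ≠ -1) :
    ∀ u v : ℝ,
      (α * u * (1 - τ₁ * v ^ 2) + v * (1 - τ₂ * u) = 0 ∧
       β * v + α * τ₁ * u * v ^ 2 + u * (γ + τ₂ * v) = 0) ↔ (u = 0 ∧ v = 0) := by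
  intro u v
  constructor
  · rintro ⟨h₁, h₂⟩
    have hβv : (β + 1) * v = 0 := by
      subst hγ
      linear_combination h₁ + h₂
    have hv : v = 0 :=
      (mul_eq_zero.mp hβv).resolve_left fun h => hβ (eq_neg_of_add_eq_zero_left h)
    subst hv
    have hαu : α * u = 0 := by linear_combination h₁
    exact ⟨(mul_eq_zero.mp hαu).resolve_left hα, rfl⟩
  · rintro ⟨rfl, rfl⟩
    simp
end
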